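/- arXiv:2604.20894 — 2 statements merged into one kernel-verified Lean document; each statement's English description precedes it below -/
import Mathlib

section
/- For every skew brace B, the kernel Ker π_B of the projection epimorphism π_B : G_B → B is an ideal of G_B contained in the socle Soc(G_B). -/
/-!
Common definitions: skew braces, set-theoretic solutions of the Yang–Baxter
equation, structure skew braces, ideals, i-homomorphisms, solubility.
-/

universe u v

/-- A skew (left) brace: two group structures `(B,+)` and `(B,·)` sharing the
same identity `0`, with `a·(b+c) = a·b − a + a·c`. -/
structure SkewBrace (B : Type u) where
  add : B → B → B
  zero : B
  neg : B → B
  mul : B → B → B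
  inv : B → B
  add_assoc : ∀ a b c, add (add a b) c = add a (add b c)
  zero_add : ∀ a, add zero a = a
  add_zero : ∀ a, add a zero = a
  neg_add : ∀ a, add (neg a) a = zero
  add_neg : ∀ a, add a (neg a) = zero
  mul_assoc : ∀ a b c, mul (mul a b) c = mul a (mul b c)
  zero_mul : ∀ a, mul zero a = a
  mul_zero : ∀ a, mul a zero = a
  inv_mul : ∀ a, mul (inv a) a = zero
  mul_inv : ∀ a, mul a (inv a) = zero
  compat : ∀ a b c, mul a (add b c) = add (add (mul a b) (neg a)) (mul a c)

namespace SkewBrace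

variable {B : Type u} (S : SkewBrace B)

/-- `λ_a(b) = −a + a·b`. -/
def lam (a b : B) : B := S.add (S.neg a) (S.mul a b)

/-- `ρ_b(a) = λ_a(b)⁻¹ · a · b`. -/
def rho (b a : B) : B := S.mul (S.mul (S.inv (S.lam a b)) a) b

/-- The solution of the YBE associated with a skew brace:
`r_B(a,b) = (λ_a(b), ρ_b(a))`. -/
def rB : B × B → B × B := fun p => (S.lam p.1 p.2, S.rho p.2 p.1)

end SkewBrace

/-- Homomorphism of skew braces: preserves both operations. -/
def IsHom {B : Type u} {C : Type v} (S : SkewBrace B) (T : SkewBrace C) (f : B → C) : Prop :=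
  (∀ a b, f (S.add a b) = T.add (f a) (f b)) ∧ (∀ a b, f (S.mul a b) = T.mul (f a) (f b))

/-- The kernel of a skew brace homomorphism: preimage of `0`. -/
def brKer {B : Type u} {C : Type v} (T : SkewBrace C) (f : B → C) : Set B :=
  {a | f a = T.zero}

/-- An ideal of a skew brace: a sub-skew brace, normal in both `(B,+)` and `(B,·)`,
and `λ_b`-invariant for all `b`. -/
def IsIdeal {B : Type u} (S : SkewBrace B) (I : Set B) : Prop :=
  S.zero ∈ I ∧
  (∀ a ∈ I, ∀ b ∈ I, S.add a b ∈ I) ∧ (∀ a ∈ I, S.neg a ∈ I) ∧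
  (∀ a ∈ I, ∀ b ∈ I, S.mul a b ∈ I) ∧ (∀ a ∈ I, S.inv a ∈ I) ∧
  (∀ b : B, ∀ a ∈ I, S.add (S.add b a) (S.neg b) ∈ I) ∧
  (∀ b : B, ∀ a ∈ I, S.mul (S.mul b a) (S.inv b) ∈ I) ∧
  (∀ b : B, S.lam b '' I = I)

/-- A skew brace is simple if it is non-trivial and its only ideals are `{0}` and `B`. -/
def IsSimpleBrace {B : Type u} (S : SkewBrace B) : Prop :=
  (∃ a : B, a ≠ S.zero) ∧
  ∀ I : Set B, IsIdeal S I → I = {S.zero} ∨ I = Set.univ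

/-- The socle of a skew brace: elements `a` with `λ_a = id` commuting additively
with everything. -/
def Soc {B : Type u} (S : SkewBrace B) : Set B :=
  {a | (∀ b, S.lam a b = b) ∧ (∀ b, S.add a b = S.add b a)}

/-- `r × id` on triples. -/
def rOne {X : Type u} (r : X × X → X × X) : X × X × X → X × X × X :=
  fun p => ((r (p.1, p.2.1)).1, (r (p.1, p.2.1)).2, p.2.2)

/-- `id × r` on triples. -/
def rTwo {X : Type u} (r : X × X → X × X) : X × X × X → X × X × X :=
  fun p => (p.1, r p.2)

/-- `(X,r)` is a set-theoretic solution of the Yang–Baxter equation. -/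
def IsSolution {X : Type u} (r : X × X → X × X) : Prop :=
  Function.Bijective r ∧
  rOne r ∘ rTwo r ∘ rOne r = rTwo r ∘ rOne r ∘ rTwo r

/-- `λ_x(y)` for a solution, i.e. the first component of `r(x,y)`. -/
def lamMap {X : Type u} (r : X × X → X × X) (x : X) : X → X := fun y => (r (x, y)).1

/-- `ρ_y(x)` for a solution, i.e. the second component of `r(x,y)`. -/
def rhoMap {X : Type u} (r : X × X → X × X) (y : X) : X → X := fun x => (r (x, y)).2

/-- Non-degeneracy: all `λ_x` and `ρ_y` are bijective. -/
def Nondeg {X : Type u} (r : X × X → X × X) : Prop :=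
  (∀ x, Function.Bijective (lamMap r x)) ∧ (∀ y, Function.Bijective (rhoMap r y))

/-- Homomorphism of solutions: `(f×f)∘r = s∘(f×f)`. -/
def IsSolHom {X : Type u} {Y : Type v} (r : X × X → X × X) (s : Y × Y → Y × Y)
    (f : X → Y) : Prop :=
  Prod.map f f ∘ r = s ∘ Prod.map f f

/-- The structure skew brace `(G_X, ι)` of a solution `(X,r)`: the image of `ι`
generates `(G_X,·)`, `ι` intertwines `r` with `r_{G_X}`, and the pair has the
universal property for maps into skew braces. -/
structure StructureBrace {X : Type u} (r : X × X → X × X) where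
  G : Type u
  S : SkewBrace G
  ι : X → G
  gen : ∀ H : Set G, S.zero ∈ H → (∀ a ∈ H, ∀ b ∈ H, S.mul a b ∈ H) →
      (∀ a ∈ H, S.inv a ∈ H) → Set.range ι ⊆ H → H = Set.univ
  compat : Prod.map ι ι ∘ r = S.rB ∘ Prod.map ι ι
  univ : ∀ {C : Type u} (T : SkewBrace C) (g : X → C),
      Prod.map g g ∘ r = T.rB ∘ Prod.map g g →
      ∃! h : G → C, IsHom S T h ∧ h ∘ ι = g

/-- The multiplicative subgroup (as a set) generated by a subset. -/
def mulClosure {B : Type u} (S : SkewBrace B) (A : Set B) : Set B :=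
  ⋂₀ {H : Set B | S.zero ∈ H ∧ (∀ a ∈ H, ∀ b ∈ H, S.mul a b ∈ H) ∧
      (∀ a ∈ H, S.inv a ∈ H) ∧ A ⊆ H}

/-- The additive subgroup (as a set) generated by a subset. -/
def addClosure {B : Type u} (S : SkewBrace B) (A : Set B) : Set B :=
  ⋂₀ {H : Set B | S.zero ∈ H ∧ (∀ a ∈ H, ∀ b ∈ H, S.add a b ∈ H) ∧
      (∀ a ∈ H, S.neg a ∈ H) ∧ A ⊆ H}

/-- The ideal generated by a subset: intersection of all ideals containing it. -/
def idealClosure {B : Type u} (S : SkewBrace B) (A : Set B) : Set B :=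
  ⋂₀ {I : Set B | IsIdeal S I ∧ A ⊆ I}

/-- Product of two subsets in the multiplicative group. -/
def setMul {B : Type u} (S : SkewBrace B) (A₁ A₂ : Set B) : Set B :=
  {c | ∃ a ∈ A₁, ∃ b ∈ A₂, c = S.mul a b}

/-- Sum of two subsets in the additive group. -/
def setAdd {B : Type u} (S : SkewBrace B) (A₁ A₂ : Set B) : Set B :=
  {c | ∃ a ∈ A₁, ∃ b ∈ A₂, c = S.add a b}

/-- The multiplicative left coset `a·I`. -/
def lCoset {B : Type u} (S : SkewBrace B) (a : B) (I : Set B) : Set B :=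
  (fun w => S.mul a w) '' I

/-- Equivalence class of the kernel relation of a map. -/
def kerClass {X : Type u} {Y : Type v} (f : X → Y) (x : X) : Set X := {z | f z = f x}

/-- `X₀` is an i-kernel of the homomorphism of solutions `f : (X,r) → (Y,s)`:
`f` is a homomorphism of solutions, `X₀` is an equivalence class of `ker f`, and
for every class `Z` of `ker f`, `r(X₀ × Z) = Z × X₀` and `r(Z × X₀) = X₀ × Z`.
A homomorphism admitting such a class is an i-homomorphism. -/
def IsIKernel {X : Type u} {Y : Type v} (r : X × X → X × X) (s : Y × Y → Y × Y)
    (f : X → Y) (X₀ : Set X) : Prop :=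
  IsSolHom r s f ∧ (∃ x : X, X₀ = kerClass f x) ∧
  ∀ z : X, r '' (X₀ ×ˢ kerClass f z) = (kerClass f z) ×ˢ X₀ ∧
           r '' ((kerClass f z) ×ˢ X₀) = X₀ ×ˢ (kerClass f z)

/-- A strong left ideal: a `λ`-invariant subgroup of `(B,+)` which is normal
in `(B,+)`. -/
def IsStrongLeftIdeal {B : Type u} (S : SkewBrace B) (I : Set B) : Prop :=
  S.zero ∈ I ∧ (∀ a ∈ I, ∀ b ∈ I, S.add a b ∈ I) ∧ (∀ a ∈ I, S.neg a ∈ I) ∧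
  (∀ b : B, S.lam b '' I = I) ∧
  (∀ b : B, ∀ a ∈ I, S.add (S.add b a) (S.neg b) ∈ I)

/-- An abelian ideal: an ideal on which the two operations coincide and are
commutative (so it is an abelian/trivial skew brace). -/
def IsAbelianIdeal {C : Type u} (T : SkewBrace C) (J : Set C) : Prop :=
  IsIdeal T J ∧ ∀ a ∈ J, ∀ b ∈ J, T.mul a b = T.add a b ∧ T.add a b = T.add b a

/-- Solubility of a skew brace: epimorphisms `f_k : B → B_k`, `0 ≤ k ≤ t`, with
`Ker f_t = 0 ⊆ … ⊆ Ker f_0 = B` and `f_k(Ker f_{k−1})` an abelian ideal of `B_k`. -/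
def IsSoluble {B : Type u} (S : SkewBrace B) : Prop :=
  ∃ (t : ℕ) (C : Fin (t + 1) → Type u) (T : ∀ k, SkewBrace (C k)) (f : ∀ k, B → C k),
    (∀ k, IsHom S (T k) (f k) ∧ Function.Surjective (f k)) ∧
    brKer (T (Fin.last t)) (f (Fin.last t)) = {S.zero} ∧
    brKer (T 0) (f 0) = Set.univ ∧
    (∀ k : Fin t, brKer (T k.succ) (f k.succ) ⊆ brKer (T k.castSucc) (f k.castSucc)) ∧
    (∀ k : Fin t, IsAbelianIdeal (T k.succ) (f k.succ '' brKer (T k.castSucc) (f k.castSucc)))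

/-- Solubility of a solution `(X,r)` (with structure skew brace `(G_X, ι)`):
there are skew braces `B_0,…,B_t`, i-epimorphisms `f_k : (X,r) → (B_k, r_{B_k})`
with i-kernels `X_k` for `0 ≤ k ≤ t−1`, and an epimorphism `f_t`, such that
`ker f_k ⊆ ker f_{k−1}`, `ker f_0` is total, `ker f_t ⊆ ker ι`, and each
`f_k(X_{k−1})` lies in an abelian ideal `J` of `B_k` with `f_k(x)·J = f_k(y)·J`
whenever `x (ker f_{k−1}) y`. -/
def IsSolubleSolution {X : Type u} (r : X × X → X × X) (GX : StructureBrace r) : Prop :=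
  ∃ (t : ℕ) (C : Fin (t + 1) → Type u) (T : ∀ k, SkewBrace (C k))
    (f : ∀ k : Fin (t + 1), X → C k) (Xk : Fin t → Set X),
    (∀ k : Fin (t + 1), IsSolHom r (T k).rB (f k) ∧ Function.Surjective (f k)) ∧
    (∀ k : Fin t, IsIKernel r (T k.castSucc).rB (f k.castSucc) (Xk k)) ∧
    (∀ x y : X, f 0 x = f 0 y) ∧
    (∀ k : Fin t, ∀ x y : X, f k.succ x = f k.succ y → f k.castSucc x = f k.castSucc y) ∧
    (∀ x y : X, f (Fin.last t) x = f (Fin.last t) y → GX.ι x = GX.ι y) ∧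
    (∀ k : Fin t, ∃ J : Set (C k.succ), IsAbelianIdeal (T k.succ) J ∧
      f k.succ '' (Xk k) ⊆ J ∧
      ∀ x y : X, f k.castSucc x = f k.castSucc y →
        lCoset (T k.succ) (f k.succ x) J = lCoset (T k.succ) (f k.succ y) J)

/-- Decomposability of a solution: `X = Y ∪ Z` with `Y, Z` proper and
`r(Y×Y) = Y×Y`, `r(Z×Z) = Z×Z`. -/
def Decomposable {X : Type u} (r : X × X → X × X) : Prop :=
  ∃ Y Z : Set X, Y ≠ Set.univ ∧ Z ≠ Set.univ ∧ Y ∪ Z = Set.univ ∧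
    r '' (Y ×ˢ Y) = Y ×ˢ Y ∧ r '' (Z ×ˢ Z) = Z ×ˢ Z

namespace SkewBrace

variable {B : Type u} (S : SkewBrace B)

/-- The additive group of a skew brace. -/
abbrev addGroup : AddGroup B :=
  { add := S.add, zero := S.zero, neg := S.neg, add_assoc := S.add_assoc,
    zero_add := S.zero_add, add_zero := S.add_zero, neg_add_cancel := S.neg_add,
    nsmul := letI : Zero B := ⟨S.zero⟩; letI : Add B := ⟨S.add⟩; nsmulRec,
    zsmul := letI : Zero B := ⟨S.zero⟩; letI : Add B := ⟨S.add⟩; letI : Neg B := ⟨S.neg⟩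
      zsmulRec }

/-- The multiplicative group of a skew brace. -/
abbrev mulGroup : Group B :=
  { mul := S.mul, one := S.zero, inv := S.inv, mul_assoc := S.mul_assoc,
    one_mul := S.zero_mul, mul_one := S.mul_zero, inv_mul_cancel := S.inv_mul,
    npow := letI : One B := ⟨S.zero⟩; letI : Mul B := ⟨S.mul⟩; npowRec,
    zpow := letI : One B := ⟨S.zero⟩; letI : Mul B := ⟨S.mul⟩; letI : Inv B := ⟨S.inv⟩
      zpowRec }

theorem neg_add_cancel_left (a b : B) : S.add (S.neg a) (S.add a b) = b := by
  rw [← S.add_assoc, S.neg_add, S.zero_add]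

theorem add_neg_cancel_left (a b : B) : S.add a (S.add (S.neg a) b) = b := by
  rw [← S.add_assoc, S.add_neg, S.zero_add]

theorem add_left_cancel {a b c : B} (h : S.add a b = S.add a c) : b = c := by
  rw [← S.neg_add_cancel_left a b, h, S.neg_add_cancel_left]

theorem neg_zero : S.neg S.zero = S.zero :=
  letI := S.addGroup
  _root_.neg_zero (G := B)

theorem neg_neg (a : B) : S.neg (S.neg a) = a :=
  letI := S.addGroup
  _root_.neg_neg a

theorem neg_add_rev (a b : B) : S.neg (S.add a b) = S.add (S.neg b) (S.neg a) :=
  letI := S.addGroup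
  _root_.neg_add_rev a b

theorem inv_zero : S.inv S.zero = S.zero :=
  letI := S.mulGroup
  inv_one (G := B)

theorem mul_eq_add_lam (a b : B) : S.mul a b = S.add a (S.lam a b) :=
  (S.add_neg_cancel_left a _).symm

theorem lam_mul_rho (a b : B) : S.mul (S.lam a b) (S.rho b a) = S.mul a b := by
  let := S.mulGroup
  change S.lam a b * ((S.lam a b)⁻¹ * a * b) = a * b
  group

theorem lam_add (a b c : B) : S.lam a (S.add b c) = S.add (S.lam a b) (S.lam a c) := by
  simp only [lam, S.compat, S.add_assoc]

theorem lam_zero (a : B) : S.lam a S.zero = S.zero := by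
  rw [lam, S.mul_zero, S.neg_add]

theorem zero_lam (b : B) : S.lam S.zero b = b := by
  rw [lam, S.zero_mul, S.neg_zero, S.zero_add]

theorem lam_neg (a b : B) : S.lam a (S.neg b) = S.neg (S.lam a b) := by
  apply S.add_left_cancel (a := S.lam a b)
  rw [← S.lam_add, S.add_neg, S.add_neg, S.lam_zero]

theorem mul_lam (a b c : B) : S.lam (S.mul a b) c = S.lam a (S.lam b c) := by
  rw [show S.lam b c = S.add (S.neg b) (S.mul b c) from rfl, S.lam_add, S.lam_neg]
  simp only [lam, S.neg_add_rev, S.neg_neg, S.add_assoc, S.add_neg_cancel_left, S.mul_assoc]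

theorem lam_inv_lam (a b : B) : S.lam a (S.lam (S.inv a) b) = b := by
  rw [← S.mul_lam, S.mul_inv, S.zero_lam]

theorem inv_lam_lam (a b : B) : S.lam (S.inv a) (S.lam a b) = b := by
  rw [← S.mul_lam, S.inv_mul, S.zero_lam]

theorem inv_eq_neg_lam (a : B) : S.inv a = S.neg (S.lam (S.inv a) a) := by
  rw [lam, S.inv_mul, S.add_zero, S.neg_neg]

theorem lam_rho_lam_inv (a b : B) :
    S.lam b (S.rho (S.lam (S.inv a) b) a) = S.add (S.neg b) (S.add a b) := by
  have h := S.lam_mul_rho a (S.lam (S.inv a) b)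
  rw [S.lam_inv_lam, S.mul_eq_add_lam, S.mul_eq_add_lam a, S.lam_inv_lam] at h
  rw [← h, S.neg_add_cancel_left]

end SkewBrace

namespace IsHom

variable {B : Type u} {C : Type v} {S : SkewBrace B} {T : SkewBrace C} {f : B → C}

theorem map_zero (hf : IsHom S T f) : f S.zero = T.zero := by
  apply T.add_left_cancel (a := f S.zero)
  rw [← hf.1, S.add_zero, T.add_zero]

theorem map_neg (hf : IsHom S T f) (a : B) : f (S.neg a) = T.neg (f a) := by
  apply T.add_left_cancel (a := f a)
  rw [← hf.1, S.add_neg, T.add_neg, hf.map_zero]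

theorem map_lam (hf : IsHom S T f) (a b : B) : f (S.lam a b) = T.lam (f a) (f b) := by
  rw [SkewBrace.lam, SkewBrace.lam, hf.1, hf.2, hf.map_neg]

theorem map_inv (hf : IsHom S T f) (a : B) : f (S.inv a) = T.inv (f a) := by
  have h : T.mul (f a) (f (S.inv a)) = T.zero := by rw [← hf.2, S.mul_inv, hf.map_zero]
  rw [← T.zero_mul (f (S.inv a)), ← T.inv_mul (f a), T.mul_assoc, h, T.mul_zero]

/-- The kernel of a homomorphism of skew braces is an ideal. -/
theorem isIdeal_brKer (hf : IsHom S T f) : IsIdeal S (brKer T f) := by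
  have lam_mem : ∀ b, ∀ a ∈ brKer T f, S.lam b a ∈ brKer T f := by
    intro b a (ha : f a = T.zero)
    change f _ = T.zero
    rw [hf.map_lam, ha, T.lam_zero]
  refine ⟨hf.map_zero, ?_, ?_, ?_, ?_, ?_, ?_, fun b => Set.Subset.antisymm ?_ ?_⟩
  · intro a (ha : f a = T.zero) b (hb : f b = T.zero)
    change f _ = T.zero
    rw [hf.1, ha, hb, T.zero_add]
  · intro a (ha : f a = T.zero)
    change f _ = T.zero
    rw [hf.map_neg, ha, T.neg_zero]
  · intro a (ha : f a = T.zero) b (hb : f b = T.zero)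
    change f _ = T.zero
    rw [hf.2, ha, hb, T.zero_mul]
  · intro a (ha : f a = T.zero)
    change f _ = T.zero
    rw [hf.map_inv, ha, T.inv_zero]
  · intro b a (ha : f a = T.zero)
    change f _ = T.zero
    rw [hf.1, hf.1, ha, T.add_zero, hf.map_neg, T.add_neg]
  · intro b a (ha : f a = T.zero)
    change f _ = T.zero
    rw [hf.2, hf.2, ha, T.mul_zero, hf.map_inv, T.mul_inv]
  · rintro _ ⟨a, ha, rfl⟩
    exact lam_mem b a ha
  · intro a ha
    exact ⟨S.lam (S.inv b) a, lam_mem _ a ha, S.lam_inv_lam b a⟩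

end IsHom

namespace StructureBrace

section

variable {X : Type u} {r : X × X → X × X} (GX : StructureBrace r)

/-- The structure skew brace is generated additively by the image of `ι`. -/
theorem add_induction {P : GX.G → Prop} (zero : P GX.S.zero)
    (add : ∀ a b, P a → P b → P (GX.S.add a b)) (neg : ∀ a, P a → P (GX.S.neg a))
    (ι : ∀ x, P (GX.ι x)) (lam : ∀ g x, ∃ y, GX.S.lam g (GX.ι x) = GX.ι y) (g : GX.G) : P g := by
  set A : Set GX.G := addClosure GX.S (Set.range GX.ι) with hA
  have zero_mem : GX.S.zero ∈ A := fun H hH => hH.1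
  have add_mem : ∀ a ∈ A, ∀ b ∈ A, GX.S.add a b ∈ A := fun a ha b hb H hH =>
    hH.2.1 a (ha H hH) b (hb H hH)
  have neg_mem : ∀ a ∈ A, GX.S.neg a ∈ A := fun a ha H hH => hH.2.2.1 a (ha H hH)
  have ι_mem : ∀ x, GX.ι x ∈ A := fun x H hH => hH.2.2.2 ⟨x, rfl⟩
  have lam_mem : ∀ g, ∀ a ∈ A, GX.S.lam g a ∈ A := by
    intro g a ha
    refine ha {a | GX.S.lam g a ∈ A} ⟨?_, fun a ha b hb => ?_, fun a ha => ?_, ?_⟩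
    · simpa only [Set.mem_ofPred_eq, GX.S.lam_zero] using zero_mem
    · simpa only [Set.mem_ofPred_eq, GX.S.lam_add] using add_mem _ ha _ hb
    · simpa only [Set.mem_ofPred_eq, GX.S.lam_neg] using neg_mem _ ha
    · rintro _ ⟨x, rfl⟩
      obtain ⟨y, hy⟩ := lam g x
      simpa only [Set.mem_ofPred_eq, hy] using ι_mem y
  have hA_univ : A = Set.univ := by
    refine GX.gen A zero_mem (fun a ha b hb => ?_) (fun a ha => ?_)
      (Set.range_subset_iff.2 ι_mem)
    · rw [GX.S.mul_eq_add_lam]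
      exact add_mem a ha _ (lam_mem a b hb)
    · rw [GX.S.inv_eq_neg_lam]
      exact neg_mem _ (lam_mem _ a ha)
  have hg : g ∈ A := hA_univ ▸ Set.mem_univ g
  refine hg {g | P g} ⟨zero, fun a ha b hb => add a b ha hb, neg, ?_⟩
  rintro _ ⟨x, rfl⟩
  exact ι x

end

variable {B : Type u} {S : SkewBrace B} (GB : StructureBrace S.rB)

theorem ι_lam (a b : B) : GB.ι (S.lam a b) = GB.S.lam (GB.ι a) (GB.ι b) :=
  congrArg Prod.fst (congrFun GB.compat (a, b))

theorem ι_rho (a b : B) : GB.ι (S.rho b a) = GB.S.rho (GB.ι b) (GB.ι a) :=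
  congrArg Prod.snd (congrFun GB.compat (a, b))

theorem neg_ι_add_ι_add_ι (a b : B) :
    GB.S.add (GB.S.neg (GB.ι b)) (GB.S.add (GB.ι a) (GB.ι b)) =
      GB.ι (S.add (S.neg b) (S.add a b)) := by
  have h : GB.S.lam (GB.S.inv (GB.ι a)) (GB.ι b) = GB.ι (S.lam (S.inv a) b) := by
    rw [← GB.S.inv_lam_lam (GB.ι a) (GB.ι (S.lam (S.inv a) b)), ← GB.ι_lam, S.lam_inv_lam]
  rw [← S.lam_rho_lam_inv, ← GB.S.lam_rho_lam_inv, GB.ι_lam, GB.ι_rho, h]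

variable {GB} {π : GB.G → B}

theorem lam_ι (hπ : IsHom GB.S S π) (hπι : π ∘ GB.ι = id) (g : GB.G) (b : B) :
    GB.S.lam g (GB.ι b) = GB.ι (S.lam (π g) b) := by
  have h : {g | ∀ b, GB.S.lam g (GB.ι b) = GB.ι (S.lam (π g) b)} = Set.univ := by
    refine GB.gen _ (fun b => ?_) (fun g hg h hh b => ?_) (fun g hg b => ?_) ?_
    · rw [hπ.map_zero, GB.S.zero_lam, S.zero_lam]
    · rw [GB.S.mul_lam, hh b, hg, hπ.2, S.mul_lam]
    · rw [← GB.S.inv_lam_lam g (GB.ι (S.lam _ b)), hg, hπ.map_inv, S.lam_inv_lam]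
    · rintro _ ⟨a, rfl⟩ b
      rw [← GB.ι_lam, show π (GB.ι a) = a from congrFun hπι a]
  exact Set.eq_univ_iff_forall.1 h g b

theorem add_induction_of_section (hπ : IsHom GB.S S π) (hπι : π ∘ GB.ι = id)
    {P : GB.G → Prop} (zero : P GB.S.zero)
    (add : ∀ a b, P a → P b → P (GB.S.add a b)) (neg : ∀ a, P a → P (GB.S.neg a))
    (ι : ∀ x, P (GB.ι x)) (g : GB.G) : P g :=
  GB.add_induction zero add neg ι (fun g x => ⟨_, lam_ι hπ hπι g x⟩) g

theorem neg_add_ι_add (hπ : IsHom GB.S S π) (hπι : π ∘ GB.ι = id) (g : GB.G) (a : B) :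
    GB.S.add (GB.S.neg g) (GB.S.add (GB.ι a) g) =
      GB.ι (S.add (S.neg (π g)) (S.add a (π g))) := by
  induction g using add_induction_of_section hπ hπι generalizing a with
  | zero => rw [hπ.map_zero, GB.S.neg_zero, S.neg_zero, GB.S.zero_add, S.zero_add,
      GB.S.add_zero, S.add_zero]
  | add g h hg hh =>
    have := hh (S.add (S.neg (π g)) (S.add a (π g)))
    rw [← hg] at this
    simpa only [hπ.1, GB.S.neg_add_rev, S.neg_add_rev, GB.S.add_assoc, S.add_assoc] using this
  | neg g hg =>
    have := hg (S.add (π g) (S.add a (S.neg (π g))))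
    simp only [S.add_assoc, S.neg_add, S.add_zero, S.neg_add_cancel_left] at this
    rw [← this, hπ.map_neg, S.neg_neg, GB.S.neg_neg, GB.S.add_assoc, GB.S.add_neg_cancel_left,
      GB.S.add_assoc, GB.S.add_neg, GB.S.add_zero]
  | ι b => rw [GB.neg_ι_add_ι_add_ι, show π (GB.ι b) = b from congrFun hπι b]

/-- The kernel of the projection `π : G_B → B` is contained in the socle of `G_B`. -/
theorem brKer_subset_soc (hπ : IsHom GB.S S π) (hπι : π ∘ GB.ι = id) :
    brKer S π ⊆ Soc GB.S := by
  intro g (hg : π g = S.zero)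
  refine ⟨fun b => ?_, fun b => ?_⟩
  · induction b using add_induction_of_section hπ hπι with
    | zero => exact GB.S.lam_zero g
    | add a b ha hb => rw [GB.S.lam_add, ha, hb]
    | neg a ha => rw [GB.S.lam_neg, ha]
    | ι a => rw [lam_ι hπ hπι, hg, S.zero_lam]
  · induction b using add_induction_of_section hπ hπι with
    | zero => rw [GB.S.add_zero, GB.S.zero_add]
    | add a b ha hb => rw [← GB.S.add_assoc, ha, GB.S.add_assoc, hb, GB.S.add_assoc]
    | neg a ha =>
      apply GB.S.add_left_cancel (a := a)
      rw [← GB.S.add_assoc, ← ha, GB.S.add_assoc, GB.S.add_neg, GB.S.add_zero,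
        GB.S.add_neg_cancel_left]
    | ι a =>
      have h := neg_add_ι_add hπ hπι g a
      rw [hg, S.neg_zero, S.zero_add, S.add_zero] at h
      rw [← GB.S.add_neg_cancel_left g (GB.S.add (GB.ι a) g), h]

end StructureBrace

/-- For every skew brace `B`, the kernel of the projection
epimorphism `π_B : G_B → B` is an ideal of `G_B` contained in `Soc(G_B)`. -/
theorem stmt_1 {B : Type u} (S : SkewBrace B) (GB : StructureBrace S.rB)
    (π : GB.G → B) (hπ : IsHom GB.S S π) (hπι : π ∘ GB.ι = id) :
    IsIdeal GB.S (brKer S π) ∧ brKer S π ⊆ Soc GB.S := by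
  exact ⟨hπ.isIdeal_brKer, StructureBrace.brKer_subset_soc hπ hπι⟩
end

section
/- For every skew brace B, the structure skew brace G_B of the associated solution (B, r_B) is not a simple skew brace. -/
/-!
Common definitions: skew braces, set-theoretic solutions of the Yang–Baxter
equation, structure skew braces, ideals, i-homomorphisms, solubility.
-/

universe u v

namespace SkewBrace

theorem eq_neg_of_add_eq_zero {B : Type u} (S : SkewBrace B) {a b : B}
    (h : S.add a b = S.zero) : b = S.neg a := by
  rw [← S.zero_add b, ← S.neg_add a, S.add_assoc, h, S.add_zero]

theorem eq_inv_of_mul_eq_zero {B : Type u} (S : SkewBrace B) {a b : B}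
    (h : S.mul a b = S.zero) : b = S.inv a := by
  rw [← S.zero_mul b, ← S.inv_mul a, S.mul_assoc, h, S.mul_zero]

theorem neg_zero_s3 {B : Type u} (S : SkewBrace B) : S.neg S.zero = S.zero :=
  (S.eq_neg_of_add_eq_zero (S.add_zero _)).symm

theorem inv_zero_s3 {B : Type u} (S : SkewBrace B) : S.inv S.zero = S.zero :=
  (S.eq_inv_of_mul_eq_zero (S.mul_zero _)).symm

theorem lam_zero_right {B : Type u} (S : SkewBrace B) (a : B) : S.lam a S.zero = S.zero := by
  simp only [lam, S.mul_zero, S.neg_add]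

theorem lam_lam_inv {B : Type u} (S : SkewBrace B) (a b : B) :
    S.lam a (S.lam (S.inv a) b) = b := by
  have h : S.lam (S.inv a) b = S.mul (S.inv a) (S.add a b) := by
    rw [S.compat, S.inv_mul, S.zero_add, lam]
  rw [h, lam, ← S.mul_assoc, S.mul_inv, S.zero_mul, ← S.add_assoc, S.neg_add, S.zero_add]

/-- The skew brace on an abelian group whose two operations coincide. -/
def trivial (A : Type u) [AddCommGroup A] : SkewBrace A where
  add a b := a + b
  zero := 0
  neg a := -a
  mul a b := a + b
  inv a := -a
  add_assoc := _root_.add_assoc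
  zero_add := _root_.zero_add
  add_zero := _root_.add_zero
  neg_add := neg_add_cancel
  add_neg := add_neg_cancel
  mul_assoc := _root_.add_assoc
  zero_mul := _root_.zero_add
  mul_zero := _root_.add_zero
  inv_mul := neg_add_cancel
  mul_inv := add_neg_cancel
  compat a b c := by abel

theorem rB_trivial {A : Type u} [AddCommGroup A] (a b : A) :
    (trivial A).rB (a, b) = (b, a) := by
  simp [rB, lam, rho, trivial]

end SkewBrace

/-- Every element `c` of an abelian group is the common value on generators of a homomorphism
from the structure skew brace to the trivial skew brace. -/
theorem StructureBrace.exists_hom_const {X : Type u} {r : X × X → X × X}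
    (GX : StructureBrace r) {A : Type u} [AddCommGroup A] (c : A) :
    ∃ h : GX.G → A, IsHom GX.S (SkewBrace.trivial A) h ∧ ∀ x, h (GX.ι x) = c := by
  obtain ⟨h, ⟨hh, hc⟩, -⟩ := GX.univ (SkewBrace.trivial A) (fun _ => c) (by
    funext p
    exact (SkewBrace.rB_trivial c c).symm)
  exact ⟨h, hh, fun x => congrFun hc x⟩

/-- The structure skew brace of a solution on a non-empty set is never simple. -/
theorem StructureBrace.not_isSimpleBrace {X : Type u} [Nonempty X] {r : X × X → X × X}
    (GX : StructureBrace r) : ¬ IsSimpleBrace GX.S := by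
  rintro ⟨-, hsimple⟩
  obtain ⟨x⟩ := ‹Nonempty X›
  obtain ⟨f, hf, hfx⟩ := GX.exists_hom_const (ULift.up (1 : ℤ))
  obtain ⟨g, hg, hgx⟩ := GX.exists_hom_const (ULift.up (1 : ZMod 2))
  rcases hsimple _ hg.isIdeal_brKer with h | h
  · have hmem : GX.S.add (GX.ι x) (GX.ι x) ∈ brKer (SkewBrace.trivial (ULift (ZMod 2))) g := by
      change g _ = _
      rw [hg.1, hgx]
      rfl
    rw [h] at hmem
    have h2 := hf.1 (GX.ι x) (GX.ι x)
    rw [Set.mem_singleton_iff.1 hmem, hf.map_zero, hfx] at h2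
    have h3 : (0 : ℤ) = 1 + 1 := congrArg ULift.down h2
    omega
  · have hmem : GX.ι x ∈ brKer (SkewBrace.trivial (ULift (ZMod 2))) g := h ▸ Set.mem_univ _
    have h1 : ULift.up (1 : ZMod 2) = 0 := (hgx x).symm.trans hmem
    exact one_ne_zero (congrArg ULift.down h1)

/-- For every skew brace `B`, the structure skew brace `G_B` of the
associated solution `(B, r_B)` is not a simple skew brace. -/
theorem stmt_3 {B : Type u} (S : SkewBrace B) (GB : StructureBrace S.rB) :
    ¬ IsSimpleBrace GB.S :=
  haveI : Nonempty B := ⟨S.zero⟩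
  GB.not_isSimpleBrace
end
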